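/- Let A be a set, let j, k ≥ 1 be natural numbers, and let {u, v}, {x₁, …, x_{j−1}}, {y₁, …, y_{k−1}} be pairwise disjoint subsets of A with u ≠ v, where x₁, …, x_{j−1} are pairwise distinct and y₁, …, y_{k−1} are pairwise distinct. Set x₀ = y₀ = u and x_j = y_k = v. Then in the complete lattice Quo(A): quo(u,v) = (⋁_{i=1}^{j} quo(x_{i−1}, x_i)) ∧ (⋁_{i=1}^{k} quo(y_{i−1}, y_i)), where ⋁ denotes join in Quo(A) and ∧ denotes intersection. -/

import Mathlib

universe u

open Set

/-- The diagonal (equality) relation on `α`, as a set of pairs. -/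
def diagRel (α : Type u) : Set (α × α) := {p | p.1 = p.2}

/-- A quasiorder (preorder): a reflexive and transitive binary relation, as a set of pairs. -/
def IsQuoRel {α : Type u} (r : Set (α × α)) : Prop :=
  (∀ a : α, (a, a) ∈ r) ∧ ∀ a b c : α, (a, b) ∈ r → (b, c) ∈ r → (a, c) ∈ r

/-- A transitive binary relation, as a set of pairs. -/
def IsTranRel {α : Type u} (r : Set (α × α)) : Prop :=
  ∀ a b c : α, (a, b) ∈ r → (b, c) ∈ r → (a, c) ∈ r

/-- An equivalence relation, as a set of pairs. -/
def IsEquRel {α : Type u} (r : Set (α × α)) : Prop :=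
  IsQuoRel r ∧ ∀ p : α × α, p ∈ r → (p.2, p.1) ∈ r

/-- `Quo(α)`: the set of all quasiorders on `α`. -/
def QuoRels (α : Type u) : Set (Set (α × α)) := {r | IsQuoRel r}

/-- `Tran(α)`: the set of all transitive relations on `α`. -/
def TranRels (α : Type u) : Set (Set (α × α)) := {r | IsTranRel r}

/-- `Equ(α)`: the set of all equivalence relations on `α`. -/
def EquRels (α : Type u) : Set (Set (α × α)) := {r | IsEquRel r}

/-- The least quasiorder containing `r` (the reflexive-transitive closure of `r`). -/
def quoGen {α : Type u} (r : Set (α × α)) : Set (α × α) := ⋂₀ {s | IsQuoRel s ∧ r ⊆ s}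

/-- The least transitive relation containing `r` (the transitive closure of `r`). -/
def tranGen {α : Type u} (r : Set (α × α)) : Set (α × α) := ⋂₀ {s | IsTranRel s ∧ r ⊆ s}

/-- The least equivalence relation containing `r`. -/
def equGen {α : Type u} (r : Set (α × α)) : Set (α × α) := ⋂₀ {s | IsEquRel s ∧ r ⊆ s}

/-- `quo(a,b)`: the least quasiorder containing the pair `(a,b)`. -/
def quoPair {α : Type u} (a b : α) : Set (α × α) := quoGen {(a, b)}

/-- `equ(a,b)`: the least equivalence relation containing the pair `(a,b)`. -/
def equPair {α : Type u} (a b : α) : Set (α × α) := equGen {(a, b)}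

/-- The involution: the inverse of a relation. -/
def invRel {α : Type u} (r : Set (α × α)) : Set (α × α) := {p | (p.2, p.1) ∈ r}

/-- `T` is closed under arbitrary (possibly infinite, possibly empty) joins and
meets of the complete lattice `Quo(α)`: the meet of a family of quasiorders is its
intersection and the join is the quasiorder generated by its union. -/
def QuoClosed {α : Type u} (T : Set (Set (α × α))) : Prop :=
  (∀ S ⊆ T, quoGen (⋃₀ S) ∈ T) ∧ (∀ S ⊆ T, ⋂₀ S ∈ T)

/-- `X` generates the complete lattice `Quo(α)` in the complete sense. -/
def QuoGenerates {α : Type u} (X : Set (Set (α × α))) : Prop :=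
  X ⊆ QuoRels α ∧ ∀ T ⊆ QuoRels α, X ⊆ T → QuoClosed T → T = QuoRels α

/-- `T` is closed under arbitrary joins and meets of the complete lattice `Tran(α)`. -/
def TranClosed {α : Type u} (T : Set (Set (α × α))) : Prop :=
  (∀ S ⊆ T, tranGen (⋃₀ S) ∈ T) ∧ (∀ S ⊆ T, ⋂₀ S ∈ T)

/-- `X` generates the complete lattice `Tran(α)` in the complete sense. -/
def TranGenerates {α : Type u} (X : Set (Set (α × α))) : Prop :=
  X ⊆ TranRels α ∧ ∀ T ⊆ TranRels α, X ⊆ T → TranClosed T → T = TranRels α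

/-- `X` generates `Quo(α)` as a complete involution lattice. -/
def QuoInvGenerates {α : Type u} (X : Set (Set (α × α))) : Prop :=
  X ⊆ QuoRels α ∧ ∀ T ⊆ QuoRels α, X ⊆ T → QuoClosed T →
    (∀ r ∈ T, invRel r ∈ T) → T = QuoRels α

/-- `X` generates `Tran(α)` as a complete involution lattice. -/
def TranInvGenerates {α : Type u} (X : Set (Set (α × α))) : Prop :=
  X ⊆ TranRels α ∧ ∀ T ⊆ TranRels α, X ⊆ T → TranClosed T →
    (∀ r ∈ T, invRel r ∈ T) → T = TranRels α

/-- Incomparability (with respect to inclusion). -/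
def Incomp {α : Type u} (a b : Set (α × α)) : Prop := ¬ a ⊆ b ∧ ¬ b ⊆ a

/-- The complete lattice `Quo(α)` is `(1+1+2)`-generated: it is generated, in the
complete sense, by a four-element set `{x₁,x₂,x₃,x₄}` with `x₁ < x₂` such that both
`{x₁,x₃,x₄}` and `{x₂,x₃,x₄}` are antichains. -/
def QuoOneOneTwoGenerated (α : Type u) : Prop :=
  ∃ x₁ x₂ x₃ x₄ : Set (α × α),
    x₁ ⊂ x₂ ∧ Incomp x₁ x₃ ∧ Incomp x₁ x₄ ∧ Incomp x₂ x₃ ∧ Incomp x₂ x₄ ∧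
    Incomp x₃ x₄ ∧ QuoGenerates {x₁, x₂, x₃, x₄}

/-- A cardinal is accessible: it is finite, or it is infinite and every cardinal
`lam ≤ κ` satisfies `lam ≤ 2 ^ μ` for some `μ < lam`, or is at most a sum of fewer
than `lam` many cardinals each smaller than `lam`. -/
def AccessibleCard (κ : Cardinal.{u}) : Prop :=
  κ < Cardinal.aleph0 ∨
    (Cardinal.aleph0 ≤ κ ∧ ∀ lam : Cardinal.{u}, lam ≤ κ →
      (∃ μ : Cardinal.{u}, μ < lam ∧ lam ≤ 2 ^ μ) ∨
      ∃ (ι : Type u) (f : ι → Cardinal.{u}),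
        Cardinal.mk ι < lam ∧ (∀ i : ι, f i < lam) ∧ lam ≤ Cardinal.sum f)
theorem subset_quoGen {α : Type u} (r : Set (α × α)) : r ⊆ quoGen r :=
  fun _ hp _ hs => hs.2 hp

theorem quoGen_subset {α : Type u} {r s : Set (α × α)} (hs : IsQuoRel s) (h : r ⊆ s) :
    quoGen r ⊆ s :=
  fun _ hp => hp s ⟨hs, h⟩

theorem isQuoRel_quoGen {α : Type u} (r : Set (α × α)) : IsQuoRel (quoGen r) :=
  ⟨fun a _ hs => hs.1.1 a, fun a b c hab hbc s hs => hs.1.2 a b c (hab s hs) (hbc s hs)⟩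

/-- The join of the `quo(z_{i-1}, z_i)` contains the pair of endpoints of the path. -/
theorem endpoints_mem_quoGen_path {α : Type u} (n : ℕ) (z : ℕ → α) :
    (z 0, z n) ∈ quoGen (⋃ i ∈ Finset.Icc 1 n, quoPair (z (i - 1)) (z i)) := by
  have h : ∀ m ≤ n,
      (z 0, z m) ∈ quoGen (⋃ i ∈ Finset.Icc 1 n, quoPair (z (i - 1)) (z i)) := by
    intro m
    induction m with
    | zero => exact fun _ => (isQuoRel_quoGen _).1 _
    | succ m ih =>
      intro hm
      refine (isQuoRel_quoGen _).2 _ _ _ (ih (by omega)) (subset_quoGen _ ?_)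
      exact mem_iUnion₂.2 ⟨m + 1, Finset.mem_Icc.2 ⟨by omega, hm⟩, subset_quoGen _ rfl⟩
  exact h n le_rfl

/-- Along an injective path, the join of the `quo(z_{i-1}, z_i)` relates distinct elements only
forwards along the path. -/
theorem exists_of_mem_quoGen_path {α : Type u} {n : ℕ} {z : ℕ → α}
    (hz : ∀ a ≤ n, ∀ b ≤ n, z a = z b → a = b) {p q : α}
    (h : (p, q) ∈ quoGen (⋃ i ∈ Finset.Icc 1 n, quoPair (z (i - 1)) (z i))) :
    p = q ∨ ∃ a b, a < b ∧ b ≤ n ∧ p = z a ∧ q = z b := by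
  have hs : IsQuoRel {r : α × α |
      r.1 = r.2 ∨ ∃ a b, a < b ∧ b ≤ n ∧ r.1 = z a ∧ r.2 = z b} := by
    refine ⟨fun a => Or.inl rfl, ?_⟩
    rintro p q r (h | ⟨a, b, hab, hb, hp, hq⟩) (h' | ⟨c, d, hcd, hd, hq', hr⟩) <;>
      dsimp only at *
    · exact Or.inl (h.trans h')
    · exact Or.inr ⟨c, d, hcd, hd, h.trans hq', hr⟩
    · exact Or.inr ⟨a, b, hab, hb, hp, h'.symm.trans hq⟩
    · have hbc : b = c := hz b hb c (by omega) (hq.symm.trans hq')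
      exact Or.inr ⟨a, d, by omega, hd, hp, hr⟩
  refine quoGen_subset hs (iUnion₂_subset fun i hi => quoGen_subset hs ?_) h
  rw [Finset.mem_Icc] at hi
  exact singleton_subset_iff.2 (Or.inr ⟨i - 1, i, by omega, hi.2, rfl, rfl⟩)

/-- A path whose interior points are distinct and avoid its distinct endpoints is injective. -/
theorem path_injective {α : Type u} {n : ℕ} {u v : α} (huv : u ≠ v) {z : ℕ → α}
    (h0 : z 0 = u) (hn : z n = v)
    (hinj : ∀ i i' : ℕ, 0 < i → i < n → 0 < i' → i' < n → z i = z i' → i = i')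
    (hne : ∀ i : ℕ, 0 < i → i < n → z i ≠ u ∧ z i ≠ v) :
    ∀ a ≤ n, ∀ b ≤ n, z a = z b → a = b := by
  have key : ∀ a b, a < b → b ≤ n → z a ≠ z b := by
    intro a b hab hb h
    rcases Nat.eq_zero_or_pos a with rfl | ha <;> rcases hb.eq_or_lt with rfl | hb'
    · exact huv (h0.symm.trans (h.trans hn))
    · exact (hne b hab hb').1 (h.symm.trans h0)
    · exact (hne a ha hab).2 (h.trans hn)
    · exact hab.ne (hinj a b ha (by omega) (by omega) hb' h)
  intro a ha b hb h
  rcases lt_trichotomy a b with hab | hab | hab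
  · exact (key a b hab hb h).elim
  · exact hab
  · exact (key b a hab ha h.symm).elim

/-- The circle principle in `Quo(A)`: if `{u,v}`, `{x₁,…,x_{j-1}}`, `{y₁,…,y_{k-1}}`
are pairwise disjoint subsets of `A` (with `u ≠ v` and the `xᵢ`'s, resp. `yᵢ`'s,
pairwise distinct), `x₀ = y₀ = u`, and `x_j = y_k = v`, then `quo(u,v)` is the
intersection of the join of the `quo(x_{i-1},x_i)` and the join of the
`quo(y_{i-1},y_i)`. -/
theorem circle_principle_quo {α : Type u} (j k : ℕ) (hj : 1 ≤ j) (hk : 1 ≤ k)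
    (u v : α) (huv : u ≠ v) (x y : ℕ → α)
    (hx0 : x 0 = u) (hxj : x j = v) (hy0 : y 0 = u) (hyk : y k = v)
    (hxinj : ∀ i i' : ℕ, 0 < i → i < j → 0 < i' → i' < j → x i = x i' → i = i')
    (hyinj : ∀ i i' : ℕ, 0 < i → i < k → 0 < i' → i' < k → y i = y i' → i = i')
    (hxuv : ∀ i : ℕ, 0 < i → i < j → x i ≠ u ∧ x i ≠ v)
    (hyuv : ∀ i : ℕ, 0 < i → i < k → y i ≠ u ∧ y i ≠ v)
    (hxy : ∀ i i' : ℕ, 0 < i → i < j → 0 < i' → i' < k → x i ≠ y i') :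
    quoPair u v =
      quoGen (⋃ i ∈ Finset.Icc 1 j, quoPair (x (i - 1)) (x i)) ∩
        quoGen (⋃ i ∈ Finset.Icc 1 k, quoPair (y (i - 1)) (y i)) := by
  have hu : ∀ {z : ℕ → α} {n : ℕ}, z 0 = u → z n = v →
      quoPair u v ⊆ quoGen (⋃ i ∈ Finset.Icc 1 n, quoPair (z (i - 1)) (z i)) := by
    rintro z n rfl rfl
    exact quoGen_subset (isQuoRel_quoGen _)
      (singleton_subset_iff.2 (endpoints_mem_quoGen_path n z))
  refine (subset_inter (hu hx0 hxj) (hu hy0 hyk)).antisymm ?_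
  rintro ⟨p, q⟩ ⟨h₁, h₂⟩
  rcases exists_of_mem_quoGen_path (path_injective huv hx0 hxj hxinj hxuv) h₁ with
    rfl | ⟨a, b, hab, hb, rfl, rfl⟩
  · exact (isQuoRel_quoGen _).1 _
  rcases exists_of_mem_quoGen_path (path_injective huv hy0 hyk hyinj hyuv) h₂ with
    h | ⟨c, d, hcd, hd, hac, hbd⟩
  · rw [h]
    exact (isQuoRel_quoGen _).1 _
  have common : ∀ s t, s ≤ j → t ≤ k → x s = y t → s = 0 ∨ s = j := by
    intro s t hs ht hst
    by_contra! hcon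
    have hs0 : 0 < s := Nat.pos_of_ne_zero hcon.1
    have hsj : s < j := lt_of_le_of_ne hs hcon.2
    rcases Nat.eq_zero_or_pos t with rfl | ht0
    · exact (hxuv s hs0 hsj).1 (hst.trans hy0)
    · rcases ht.eq_or_lt with rfl | htk
      · exact (hxuv s hs0 hsj).2 (hst.trans hyk)
      · exact hxy s t hs0 hsj ht0 htk hst
  obtain rfl : a = 0 := by
    have := common a c (by omega) (by omega) hac
    omega
  obtain rfl : b = j := by
    have := common b d hb hd hbd
    omega
  rw [hx0, hxj]
  exact subset_quoGen _ rfl
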